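/- Let x ∈ (0,1) be irrational and let j ≥ 0 be such that a_{j+1} > 1. Then 0 < Θ(x, (p_j + p_{j−1})/(q_j + q_{j−1})) − Θ(x, p_{j−1}/q_{j−1}) < 1, and |Θ(x, ((a_{j+1} − 1) p_j + p_{j−1})/((a_{j+1} − 1) q_j + q_{j−1})) − Θ(x, (p_j + p_{j−1})/(q_j + q_{j−1}))| < 1. -/

import Mathlib

open MeasureTheory Filter Topology
open scoped Classical

noncomputable section

/-- The Farey tent map `F`. -/
def fareyMap (x : ℝ) : ℝ := if x ≤ 1/2 then x / (1 - x) else (1 - x) / x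

/-- `eps x n = ε_{n+1}(x)`, i.e. `0` if `F^[n] x ≤ 1/2` and `1` otherwise. -/
def eps (x : ℝ) (n : ℕ) : ℤ := if fareyMap^[n] x ≤ 1/2 then 0 else 1

/-- The matrices `A_0 = [[1,0],[1,1]]` and `A_1 = [[0,1],[1,1]]`. -/
def Amat (e : ℤ) : Matrix (Fin 2) (Fin 2) ℤ := !![1 - e, e; 1, 1]

/-- `Mmat x n = A_{ε_1(x)} ⋯ A_{ε_n(x)}`, with `Mmat x 0` the identity. -/
def Mmat (x : ℝ) : ℕ → Matrix (Fin 2) (Fin 2) ℤ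
  | 0 => 1
  | n + 1 => Mmat x n * Amat (eps x n)

/-- `u_n(x)`: top-left entry of `M_n(x)`. -/
def uF (x : ℝ) (n : ℕ) : ℤ := Mmat x n 0 0

/-- `s_n(x)`: bottom-left entry of `M_n(x)`. -/
def sF (x : ℝ) (n : ℕ) : ℤ := Mmat x n 1 0

/-- Ito's natural extension `F̄` of the Farey tent map. -/
def fareyNE (p : ℝ × ℝ) : ℝ × ℝ :=
  if p.1 ≤ 1/2 then (p.1 / (1 - p.1), p.2 / (1 + p.2))
  else ((1 - p.1) / p.1, 1 / (1 + p.2))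

/-- `Ω = [0,1]²`. -/
def OmegaSet : Set (ℝ × ℝ) := Set.Icc (0:ℝ) 1 ×ˢ Set.Icc (0:ℝ) 1

/-- The measure `μ̄` on `Ω` with density `(x + y − xy)⁻²` w.r.t. Lebesgue measure. -/
def muBar : Measure (ℝ × ℝ) :=
  (volume.restrict OmegaSet).withDensity
    (fun p => ENNReal.ofReal (1 / (p.1 + p.2 - p.1 * p.2) ^ 2))

/-- A proper inducible subregion of `Ω`. -/
def ProperInducible (R : Set (ℝ × ℝ)) : Prop :=
  R ⊆ OmegaSet ∧ MeasurableSet R ∧ 0 < muBar R ∧ muBar R < ⊤ ∧ muBar (frontier R) = 0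

/-- `hitsR R x k` holds iff `k ≥ 1` and `F̄^[k] (x,1) ∈ R`. -/
def hitsR (R : Set (ℝ × ℝ)) (x : ℝ) (k : ℕ) : Prop := 1 ≤ k ∧ fareyNE^[k] (x, 1) ∈ R

/-- `Nidx R x n = N_n`: `N_0 = 0` and, for `n ≥ 1`, the `n`-th smallest `k ≥ 1`
with `F̄^[k] (x,1) ∈ R`. -/
def Nidx (R : Set (ℝ × ℝ)) (x : ℝ) : ℕ → ℕ
  | 0 => 0
  | n + 1 => Nat.nth (hitsR R x) n

/-- `h(x,y) = (1−y)/(x + y − xy)`. -/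
def hIto (p : ℝ × ℝ) : ℝ := (1 - p.2) / (p.1 + p.2 - p.1 * p.2)

/-- `Θ_n(x) = s_n(x)·|s_n(x)·x − u_n(x)|`, the approximation coefficient of the
`n`-th Farey convergent `u_n(x)/s_n(x)`. -/
def ThetaF (x : ℝ) (n : ℕ) : ℝ := (sF x n : ℝ) * |(sF x n : ℝ) * x - (uF x n : ℝ)|

/-- `Θ_n^R(x) = s_n^R·|s_n^R·x − u_n^R|` where `u_n^R = u_{N_n}(x)`, `s_n^R = s_{N_n}(x)`. -/
def ThetaR (R : Set (ℝ × ℝ)) (x : ℝ) (n : ℕ) : ℝ := ThetaF x (Nidx R x n)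

/-- The Gauss map. -/
def gaussMap (x : ℝ) : ℝ := Int.fract (1 / x)

/-- `pquot x n` is the RCF partial quotient `a_{n+1}(x)`. -/
def pquot (x : ℝ) (n : ℕ) : ℤ := ⌊1 / (gaussMap^[n] x)⌋

/-- `pnum x (j+1)` is the RCF numerator `p_j(x)`; `pnum x 0 = p_{-1} = 1`. -/
def pnum (x : ℝ) : ℕ → ℤ
  | 0 => 1
  | 1 => 0
  | n + 2 => pquot x n * pnum x (n + 1) + pnum x n

/-- `qden x (j+1)` is the RCF denominator `q_j(x)`; `qden x 0 = q_{-1} = 0`. -/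
def qden (x : ℝ) : ℕ → ℤ
  | 0 => 0
  | 1 => 1
  | n + 2 => pquot x n * qden x (n + 1) + qden x n

/-- The approximation coefficient `Θ(x, p/q) = q·|q·x − p|`. -/
def Theta (x : ℝ) (p q : ℤ) : ℝ := (q : ℝ) * |(q : ℝ) * x - (p : ℝ)|

/-- `medTheta x l j = Θ(x, (l·p_j + p_{j−1})/(l·q_j + q_{j−1}))`. -/
def medTheta (x : ℝ) (l : ℤ) (j : ℕ) : ℝ :=
  Theta x (l * pnum x (j + 1) + pnum x j) (l * qden x (j + 1) + qden x j)

end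

theorem gaussMap_irrational_mem_Ioo {t : ℝ} (ht : Irrational t) :
    Irrational (gaussMap t) ∧ gaussMap t ∈ Set.Ioo (0 : ℝ) 1 := by
  have hirr : Irrational (gaussMap t) := by
    have h := ht.inv.sub_intCast ⌊1 / t⌋
    rwa [← one_div] at h
  exact ⟨hirr, lt_of_le_of_ne (Int.fract_nonneg _) (Ne.symm hirr.ne_zero), Int.fract_lt_one _⟩

theorem iterate_gaussMap_irrational_mem_Ioo {x : ℝ} (hx : x ∈ Set.Ioo (0 : ℝ) 1)
    (hirr : Irrational x) (n : ℕ) :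
    Irrational (gaussMap^[n] x) ∧ gaussMap^[n] x ∈ Set.Ioo (0 : ℝ) 1 := by
  cases n with
  | zero => exact ⟨hirr, hx⟩
  | succ n =>
    have h : Irrational (gaussMap^[n] x) := by
      induction n with
      | zero => exact hirr
      | succ n ih =>
        rw [Function.iterate_succ_apply']
        exact (gaussMap_irrational_mem_Ioo ih).1
    rw [Function.iterate_succ_apply']
    exact gaussMap_irrational_mem_Ioo h

theorem iterate_gaussMap_succ (x : ℝ) (n : ℕ) :
    gaussMap^[n + 1] x = 1 / gaussMap^[n] x - pquot x n := by
  rw [Function.iterate_succ_apply']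
  rfl

theorem one_le_pquot {x : ℝ} (hx : x ∈ Set.Ioo (0 : ℝ) 1) (hirr : Irrational x) (n : ℕ) :
    1 ≤ pquot x n := by
  obtain ⟨-, h0, h1⟩ := iterate_gaussMap_irrational_mem_Ioo hx hirr n
  exact Int.le_floor.2 (by simpa using (one_le_div h0).2 h1.le)

theorem qden_bounds {x : ℝ} (hx : x ∈ Set.Ioo (0 : ℝ) 1) (hirr : Irrational x) (n : ℕ) :
    0 ≤ qden x n ∧ qden x n ≤ qden x (n + 1) ∧ 1 ≤ qden x (n + 1) := by
  induction n with
  | zero => simp [qden]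
  | succ n ih =>
    have ha := one_le_pquot hx hirr n
    have h : qden x (n + 2) = pquot x n * qden x (n + 1) + qden x n := rfl
    refine ⟨by omega, ?_, ?_⟩ <;> rw [h] <;> nlinarith

theorem qden_mul_sub_pnum_succ {x : ℝ} (hx : x ∈ Set.Ioo (0 : ℝ) 1) (hirr : Irrational x)
    (n : ℕ) :
    (qden x (n + 1) : ℝ) * x - pnum x (n + 1) =
      -(gaussMap^[n] x) * (qden x n * x - pnum x n) := by
  induction n with
  | zero => simp [qden, pnum]
  | succ n ih =>
    have h0 := (iterate_gaussMap_irrational_mem_Ioo hx hirr n).2.1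
    have hq : qden x (n + 2) = pquot x n * qden x (n + 1) + qden x n := rfl
    have hp : pnum x (n + 2) = pquot x n * pnum x (n + 1) + pnum x n := rfl
    have ht : gaussMap^[n] x * (gaussMap^[n + 1] x + pquot x n) = 1 := by
      rw [iterate_gaussMap_succ, sub_add_cancel, mul_one_div_cancel h0.ne']
    rw [hq, hp]
    push_cast
    linear_combination
      (pquot x n + gaussMap^[n + 1] x) * ih - (qden x n * x - pnum x n) * ht

theorem abs_qden_mul_sub_pnum_mul {x : ℝ} (hx : x ∈ Set.Ioo (0 : ℝ) 1) (hirr : Irrational x)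
    (n : ℕ) :
    |(qden x n : ℝ) * x - pnum x n| * (qden x (n + 1) + qden x n * gaussMap^[n] x) = 1 := by
  induction n with
  | zero => simp [qden, pnum]
  | succ n ih =>
    have h0 := (iterate_gaussMap_irrational_mem_Ioo hx hirr n).2.1
    have hq : qden x (n + 2) = pquot x n * qden x (n + 1) + qden x n := rfl
    have ht : gaussMap^[n] x * (gaussMap^[n + 1] x + pquot x n) = 1 := by
      rw [iterate_gaussMap_succ, sub_add_cancel, mul_one_div_cancel h0.ne']
    rw [qden_mul_sub_pnum_succ hx hirr, hq, abs_mul, abs_neg, abs_of_pos h0]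
    push_cast
    linear_combination ih + |(qden x n : ℝ) * x - pnum x n| * qden x (n + 1) * ht

theorem medTheta_eq {x : ℝ} (hx : x ∈ Set.Ioo (0 : ℝ) 1) (hirr : Irrational x) (n : ℕ) {l : ℤ}
    (hl : l * gaussMap^[n] x ≤ 1) :
    medTheta x l n = (l * qden x (n + 1) + qden x n) *
      (|(qden x n : ℝ) * x - pnum x n| * (1 - l * gaussMap^[n] x)) := by
  have h := qden_mul_sub_pnum_succ hx hirr n
  have h' : ((l * qden x (n + 1) + qden x n : ℤ) : ℝ) * x -
      (l * pnum x (n + 1) + pnum x n : ℤ) =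
      (qden x n * x - pnum x n) * (1 - l * gaussMap^[n] x) := by
    push_cast
    linear_combination l * h
  rw [medTheta, Theta, h', abs_mul, abs_of_nonneg (sub_nonneg.2 hl)]
  push_cast
  rfl

/-- Consecutive RCF convergents and extreme mediants: for `a_{j+1} > 1`,
`0 < Θ(first mediant) − Θ(p_{j−1}/q_{j−1}) < 1` and
`|Θ(final mediant) − Θ(first mediant)| < 1`. -/
theorem stmt_18 (x : ℝ) (hx : x ∈ Set.Ioo (0:ℝ) 1) (hirr : Irrational x)
    (j : ℕ) (ha : 1 < pquot x j) :
    (0 < medTheta x 1 j - Theta x (pnum x j) (qden x j) ∧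
      medTheta x 1 j - Theta x (pnum x j) (qden x j) < 1) ∧
    |medTheta x (pquot x j - 1) j - medTheta x 1 j| < 1 := by
  obtain ⟨htirr, ht0, ht1⟩ := iterate_gaussMap_irrational_mem_Ioo hx hirr j
  obtain ⟨-, ht0', ht1'⟩ := iterate_gaussMap_irrational_mem_Ioo hx hirr (j + 1)
  obtain ⟨hr0, hrq, hq1⟩ := qden_bounds hx hirr j
  have hd := abs_qden_mul_sub_pnum_mul hx hirr j
  have hmul : gaussMap^[j] x * (gaussMap^[j + 1] x + pquot x j) = 1 := by
    rw [iterate_gaussMap_succ, sub_add_cancel, mul_one_div_cancel ht0.ne']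
  have hat : pquot x j * gaussMap^[j] x < 1 := by nlinarith
  have hat' : 1 < (pquot x j + 1) * gaussMap^[j] x := by nlinarith
  have ha2 : (2 : ℝ) ≤ pquot x j := by exact_mod_cast ha
  rw [medTheta_eq hx hirr j (l := 1) (by push_cast; linarith),
    medTheta_eq hx hirr j (l := pquot x j - 1) (by push_cast; linarith), Theta]
  push_cast
  have hr0 : (0 : ℝ) ≤ qden x j := by exact_mod_cast hr0
  have hrq : (qden x j : ℝ) ≤ qden x (j + 1) := by exact_mod_cast hrq
  have hq1 : (1 : ℝ) ≤ qden x (j + 1) := by exact_mod_cast hq1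
  generalize gaussMap^[j] x = t at *
  have hd0 : 0 ≤ |(qden x j : ℝ) * x - pnum x j| := abs_nonneg _
  generalize |(qden x j : ℝ) * x - pnum x j| = d at *
  generalize (qden x j : ℝ) = r at *
  generalize (qden x (j + 1) : ℝ) = q at *
  generalize (pquot x j : ℝ) = a at *
  have hdpos : 0 < d := lt_of_le_of_ne hd0 (by rintro rfl; simp at hd)
  have ht2 : 2 * t < 1 := by nlinarith
  have hrt : 0 ≤ r * t := mul_nonneg hr0 ht0.le
  have hqt : 0 < q * t := by positivity
  refine ⟨⟨?_, ?_⟩, ?_⟩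
  · have h : 0 < q - q * t - r * t := by nlinarith
    linarith [mul_pos hdpos h]
  · linarith [mul_pos hdpos hqt, mul_nonneg hd0 hrt]
  · have key : (a - 2) * t < 1 := by linarith
    have key0 : 0 ≤ (a - 2) * t := mul_nonneg (by linarith) ht0.le
    have hup : (a - 2) * (1 - a * t) < 1 := by nlinarith
    have hup0 : 0 ≤ (a - 2) * (1 - a * t) := mul_nonneg (by linarith) (by linarith)
    have h1 : (a - 2) * (q * (1 - a * t) - r * t) < q + r * t := by
      nlinarith [mul_nonneg key0 hr0]
    have h2 : -(q + r * t) < (a - 2) * (q * (1 - a * t) - r * t) := by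
      nlinarith [mul_nonneg hup0 (by linarith : (0 : ℝ) ≤ q)]
    rw [abs_lt]
    constructor
    · linarith [mul_lt_mul_of_pos_left h2 hdpos]
    · linarith [mul_lt_mul_of_pos_left h1 hdpos]
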